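/- Fix a ≥ 1 and let ℓ = lcm(1,...,a+1). The function k ↦ p_a(k), counting plane partitions of k inside a 2 × a rectangle, is a quasipolynomial of degree 2a-1 and period dividing ℓ: there exist polynomials f_0,...,f_{ℓ-1} of degree at most 2a-1, with at least one of degree exactly 2a-1, such that p_a(k) = f_{k mod ℓ}(k) for all k ≥ 0. -/

import Mathlib

open Polynomial

/-- Number of plane partitions of `k` fitting inside a `2 × a` rectangle. -/
noncomputable def planePartitionCount (a k : ℕ) : ℕ :=
  Nat.card {f : Fin 2 → Fin a → ℕ //
    (∀ i : Fin 2, ∀ j j' : Fin a, j ≤ j' → f i j' ≤ f i j) ∧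
    (∀ j : Fin a, f 1 j ≤ f 0 j) ∧
    ∑ i, ∑ j, f i j = k}

namespace PPQ

/-- Two-rowed plane partitions with at most `a` columns, as pairs of sequences. -/
def T (a : ℕ) : Type :=
  {p : (ℕ → ℕ) × (ℕ → ℕ) //
    (∀ j, p.1 (j + 1) ≤ p.1 j) ∧ (∀ j, p.2 (j + 1) ≤ p.2 j) ∧ (∀ j, p.2 j ≤ p.1 j) ∧
      ∀ j, a ≤ j → p.1 j = 0}

/-- The weight, where one diagonal has multiplicity `e + 1`. -/
def w (a e : ℕ) (p : T a) : ℕ :=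
  ∑ j ∈ Finset.range a, (p.1.1 j + p.1.2 j) + e * (p.1.1 0 + p.1.2 1)

/-- First sequence after rebuilding a column. -/
def bx (x y : ℕ → ℕ) (m n : ℕ) : ℕ → ℕ
  | 0 => m + max (x 0) (n + y 0)
  | j + 1 => x j

/-- Second sequence after rebuilding a column. -/
def bY (x y : ℕ → ℕ) (n : ℕ) : ℕ → ℕ
  | 0 => n + y 0
  | 1 => min (x 0) (n + y 0) + y 1 - y 0
  | j + 2 => y (j + 1)

/-- Second sequence after removing a column. -/
def fY (x y : ℕ → ℕ) : ℕ → ℕ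
  | 0 => min (x 1) (y 0) + y 2 - y 1
  | j + 1 => y (j + 2)

/-- Toggle bijection. -/
def toggle (a : ℕ) : T (a + 1) ≃ (T a × ℕ) × ℕ where
  toFun p := ((⟨(fun j => p.1.1 (j + 1), fY p.1.1 p.1.2), by
      obtain ⟨⟨x, y⟩, h1, h2, h3, h4⟩ := p
      simp only at h1 h2 h3 h4 ⊢
      refine ⟨fun j => h1 _, ?_, ?_, fun j hj => h4 _ (by omega)⟩
      · rintro (_ | j)
        · simp only [fY]
          have := h2 0; have := h2 1; have := h3 1
          simp only [Nat.reduceAdd, zero_add] at *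
          omega
        · exact h2 _
      · rintro (_ | j)
        · simp only [fY]
          have := h2 0; have := h2 1; have := h3 1
          simp only [Nat.reduceAdd, zero_add] at *
          omega
        · exact h3 _⟩,
    p.1.1 0 - max (p.1.1 1) (p.1.2 0)), p.1.2 0 - fY p.1.1 p.1.2 0)
  invFun q := ⟨(bx q.1.1.1.1 q.1.1.1.2 q.1.2 q.2, bY q.1.1.1.1 q.1.1.1.2 q.2), by
      obtain ⟨⟨⟨⟨x, y⟩, h1, h2, h3, h4⟩, m⟩, n⟩ := q
      simp only at h1 h2 h3 h4 ⊢
      have := h2 0; have := h3 0; have := h3 1; have := h1 0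
      simp only [Nat.reduceAdd, zero_add] at *
      refine ⟨?_, ?_, ?_, ?_⟩
      · rintro (_ | j)
        · simp only [bx]; omega
        · exact h1 _
      · rintro (_ | _ | j)
        · simp only [bY, zero_add]; omega
        · simp only [bY, zero_add, Nat.reduceAdd]; omega
        · exact h2 _
      · rintro (_ | _ | j)
        · simp only [bx, bY]; omega
        · simp only [bx, bY]; omega
        · exact h3 _
      · rintro (_ | j) hj
        · omega
        · exact h4 _ (by omega)⟩
  left_inv p := by
    obtain ⟨⟨x, y⟩, h1, h2, h3, h4⟩ := p
    simp only at h1 h2 h3 h4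
    have := h2 0; have := h2 1; have := h3 0; have := h3 1; have := h1 0
    simp only [Nat.reduceAdd, zero_add] at *
    apply Subtype.ext
    apply Prod.ext
    · funext j
      rcases j with (_ | j)
      · simp only [bx, fY, zero_add]; omega
      · rfl
    · funext j
      rcases j with (_ | _ | j)
      · simp only [bY, fY]; omega
      · simp only [bY, fY, Nat.reduceAdd, zero_add]; omega
      · rfl
  right_inv q := by
    obtain ⟨⟨⟨⟨x, y⟩, h1, h2, h3, h4⟩, m⟩, n⟩ := q
    simp only at h1 h2 h3 h4
    have := h2 0; have := h3 0; have := h3 1; have := h1 0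
    simp only [Nat.reduceAdd, zero_add] at *
    refine Prod.ext (Prod.ext (Subtype.ext (Prod.ext rfl ?_)) ?_) ?_
    · funext j
      rcases j with (_ | j)
      · simp only [bx, bY, fY, zero_add]; omega
      · rfl
    · simp only [bx, bY, zero_add]; omega
    · simp only [bx, bY, fY, zero_add]; omega

lemma w_toggle (a e : ℕ) (p : T (a + 1)) :
    w (a + 1) e p =
      (w a (e + 1) (toggle a p).1.1 + (e + 1) * (toggle a p).1.2) + (e + 2) * (toggle a p).2 := by
  obtain ⟨⟨x, y⟩, h1, h2, h3, h4⟩ := p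
  simp only at h1 h2 h3 h4
  have i1 := h2 0; have i2 := h2 1; have i3 := h3 0; have i4 := h3 1; have i5 := h1 0
  simp only [Nat.reduceAdd, zero_add] at *
  obtain ⟨u, hu⟩ : ∃ u, u = fY x y 0 := ⟨_, rfl⟩
  obtain ⟨m, hm⟩ : ∃ u, u = x 0 - max (x 1) (y 0) := ⟨_, rfl⟩
  obtain ⟨n, hn⟩ : ∃ n, n = y 0 - u := ⟨_, rfl⟩
  have e1 : y 0 = n + u := by simp only [fY] at hu; omega
  have e2 : x 0 + y 1 = m + x 1 + y 2 + n := by simp only [fY] at hu; omega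
  change ∑ j ∈ Finset.range (a + 1), (x j + y j) + e * (x 0 + y 1) =
    (∑ j ∈ Finset.range a, (x (j + 1) + fY x y j) + (e + 1) * (x 1 + y 2)) +
      (e + 1) * (x 0 - max (x 1) (y 0)) + (e + 2) * (y 0 - fY x y 0)
  rw [← hu, ← hm, ← hn]
  rcases a with (_ | a)
  · have j1 := h4 1 le_rfl
    have := h4 2 (by omega)
    have := h3 2
    have h0 : y 1 = 0 := by omega
    have h02 : y 2 = 0 := by omega
    have h00 : u = 0 := by simp only [fY] at hu; omega
    have hx : x 0 = m + n := by omega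
    simp only [zero_add, Finset.sum_range_one, Finset.sum_range_zero]
    rw [e1, hx, h0, h02, h00, j1]
    ring
  · rw [Finset.sum_range_succ', Finset.sum_range_succ', Finset.sum_range_succ', ← hu]
    have hf : ∀ k, fY x y (k + 1) = y (k + 2) := fun k => rfl
    simp only [hf, zero_add, add_assoc, Nat.reduceAdd]
    generalize ∑ k ∈ Finset.range a, (x (k + 2) + y (k + 2)) = S
    have hx : (x 0 : ℤ) = m + x 1 + y 2 + n - y 1 := by omega
    zify at e1 ⊢
    rw [e1, hx]
    ring

/-- Number of elements of weight `k`. -/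
noncomputable def cnt {α : Type} (v : α → ℕ) (k : ℕ) : ℕ := Nat.card {x // v x = k}

lemma finite_step {α : Type} (v : α → ℕ) (d : ℕ) (hd : 1 ≤ d)
    (hf : ∀ k, Finite {x // v x = k}) (k : ℕ) :
    Finite {x : α × ℕ // v x.1 + d * x.2 = k} := by
  have hb : ∀ x : α × ℕ, v x.1 + d * x.2 = k → x.2 < k + 1 := by
    intro x hx
    have := Nat.le_mul_of_pos_left x.2 hd
    omega
  let g : {x : α × ℕ // v x.1 + d * x.2 = k} → Σ m : Fin (k + 1), {x // v x = k - d * m.1} :=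
    fun x => ⟨⟨x.1.2, hb _ x.2⟩, ⟨x.1.1, by have := x.2; simp only; omega⟩⟩
  apply Finite.of_injective g
  rintro ⟨⟨x, m⟩, h⟩ ⟨⟨x', m'⟩, h'⟩ hg
  simp only [g, Sigma.mk.injEq, Fin.mk.injEq] at hg
  obtain ⟨rfl, h2⟩ := hg
  simpa using h2

lemma cnt_step {α : Type} (v : α → ℕ) (d : ℕ) (hd : 1 ≤ d)
    (hf : ∀ k, Finite {x // v x = k}) (k : ℕ) :
    cnt (fun x : α × ℕ => v x.1 + d * x.2) k =
      cnt v k + if d ≤ k then cnt (fun x : α × ℕ => v x.1 + d * x.2) (k - d) else 0 := by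
  have := finite_step v d hd hf
  split_ifs with h
  · unfold cnt
    rw [← Nat.card_sum]
    symm
    apply Nat.card_congr
    refine Equiv.ofBijective (Sum.elim (fun x => ⟨(x.1, 0), by simpa using x.2⟩)
      (fun x => ⟨(x.1.1, x.1.2 + 1), by
        have h' : v x.1.1 + d * x.1.2 = k - d := x.2
        simp only [mul_add]; omega⟩)) ⟨?_, ?_⟩
    · rintro (⟨x, hx⟩ | ⟨⟨x, m⟩, hx⟩) (⟨y, hy⟩ | ⟨⟨y, n⟩, hy⟩) hxy <;> simp_all
    · rintro ⟨⟨x, (_ | m)⟩, hx⟩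
      · exact ⟨Sum.inl ⟨x, by simpa using hx⟩, rfl⟩
      · exact ⟨Sum.inr ⟨(x, m), by simp only [mul_add] at hx ⊢; omega⟩, rfl⟩
  · unfold cnt
    rw [add_zero]
    symm
    apply Nat.card_congr
    refine Equiv.ofBijective (fun x => ⟨(x.1, 0), by simpa using x.2⟩) ⟨?_, ?_⟩
    · rintro ⟨x, hx⟩ ⟨y, hy⟩ hxy; simp_all
    · rintro ⟨⟨x, (_ | m)⟩, hx⟩
      · exact ⟨⟨x, by simpa using hx⟩, rfl⟩
      · exfalso; simp only [mul_add] at hx; omega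

/-- Generating function. -/
noncomputable def gf {α : Type} (v : α → ℕ) : PowerSeries ℚ := PowerSeries.mk fun k => (cnt v k : ℚ)

lemma gf_step {α : Type} (v : α → ℕ) (d : ℕ) (hd : 1 ≤ d)
    (hf : ∀ k, Finite {x // v x = k}) :
    gf (fun x : α × ℕ => v x.1 + d * x.2) * (1 - PowerSeries.X ^ d) = gf v := by
  ext k
  rw [mul_sub, mul_one, map_sub, PowerSeries.coeff_mul_X_pow']
  simp only [gf, PowerSeries.coeff_mk]
  rw [cnt_step v d hd hf k]
  split_ifs <;> simp

/-- Rational generating function of the required kind. -/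
def Good (ℓ D : ℕ) (G : PowerSeries ℚ) : Prop :=
  ∃ p : ℚ[X], p.natDegree + D ≤ D * ℓ ∧ (∀ n, 0 ≤ p.coeff n) ∧ p.coeff 0 = 1 ∧
    G * (1 - PowerSeries.X ^ ℓ) ^ D = (p : PowerSeries ℚ)

lemma good_step (ℓ D d : ℕ) (hd : 1 ≤ d) (hℓ : 1 ≤ ℓ) (hdl : d ∣ ℓ) (G H : PowerSeries ℚ)
    (h : G * (1 - PowerSeries.X ^ d) = H) (hH : Good ℓ D H) : Good ℓ (D + 1) G := by
  obtain ⟨p, h1, h2, h3, h4⟩ := hH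
  obtain ⟨c, rfl⟩ := hdl
  have hc : 1 ≤ c := by
    rcases c with (_ | c)
    · simp at hℓ
    · omega
  set s : ℚ[X] := ∑ i ∈ Finset.range c, (X ^ d) ^ i with hs
  have hsdeg : s.natDegree ≤ d * (c - 1) := by
    apply natDegree_sum_le_of_forall_le
    intro i hi
    rw [← pow_mul]
    refine (natDegree_X_pow_le _).trans ?_
    rw [Finset.mem_range] at hi
    exact Nat.mul_le_mul_left _ (by omega)
  have hscoeff : ∀ n, 0 ≤ s.coeff n := by
    intro n
    rw [hs, finsetSum_coeff]
    apply Finset.sum_nonneg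
    intro i _
    rw [← pow_mul, coeff_X_pow]
    split_ifs <;> norm_num
  have hs0 : s.coeff 0 = 1 := by
    obtain ⟨c, rfl⟩ : ∃ c', c = c' + 1 := ⟨c - 1, by omega⟩
    rw [hs, Finset.sum_range_succ']
    simp [coeff_zero_eq_eval_zero, eval_finsetSum, show d ≠ 0 by omega]
  refine ⟨p * s, ?_, ?_, ?_, ?_⟩
  · have := natDegree_mul_le (p := p) (q := s)
    obtain ⟨c, rfl⟩ : ∃ c', c = c' + 1 := ⟨c - 1, by omega⟩
    simp only [Nat.add_sub_cancel] at hsdeg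
    have : (D + 1) * (d * (c + 1)) = D * (d * (c + 1)) + d * c + d := by ring
    omega
  · intro n
    rw [coeff_mul]
    exact Finset.sum_nonneg fun x _ => mul_nonneg (h2 _) (hscoeff _)
  · rw [mul_coeff_zero, h3, hs0, one_mul]
  · have hgeom : (1 - PowerSeries.X ^ (d * c) : PowerSeries ℚ) =
        (1 - PowerSeries.X ^ d) * (s : PowerSeries ℚ) := by
      have : (1 - X ^ (d * c) : ℚ[X]) = (1 - X ^ d) * s := by
        rw [hs, pow_mul, mul_neg_geom_sum]
      have := congrArg (fun q : ℚ[X] => (q : PowerSeries ℚ)) this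
      simpa using this
    rw [Polynomial.coe_mul, ← h4, ← h, pow_succ]
    nth_rewrite 2 [hgeom]
    ring

lemma cnt_congr {α β : Type} (e : α ≃ β) (v : α → ℕ) (u : β → ℕ) (h : ∀ x, v x = u (e x)) (k : ℕ) :
    cnt v k = cnt u k :=
  Nat.card_congr (e.subtypeEquiv fun x => by rw [h])

lemma T_zero (p : T 0) : p = ⟨(fun _ => 0, fun _ => 0), by simp⟩ := by
  obtain ⟨⟨x, y⟩, h1, h2, h3, h4⟩ := p
  simp only at h1 h2 h3 h4
  have hx : x = fun _ => 0 := funext fun j => h4 j (Nat.zero_le _)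
  subst hx
  have hy : y = fun _ => 0 := funext fun j => by have := h3 j; simp only at this; omega
  subst hy
  rfl

lemma main_gf (ℓ : ℕ) (hℓ : 1 ≤ ℓ) (a : ℕ) : ∀ e, (∀ d, 1 ≤ d → d ≤ e + a + 1 → d ∣ ℓ) →
    (∀ k, Finite {x // w a e x = k}) ∧ Good ℓ (2 * a) (gf (w a e)) := by
  induction a with
  | zero =>
    intro e _
    have hs : Subsingleton (T 0) := ⟨fun p q => (T_zero p).trans (T_zero q).symm⟩
    refine ⟨fun k => inferInstance, 1, by simp, ?_, by simp, ?_⟩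
    · intro n; rw [coeff_one]; split_ifs <;> norm_num
    · ext k
      have hw : ∀ p, w 0 e p = 0 := by
        intro p
        rw [T_zero p]
        simp [w]
      simp only [gf, mul_zero, pow_zero, mul_one, PowerSeries.coeff_mk, Polynomial.coe_one,
        PowerSeries.coeff_one, cnt, hw]
      split_ifs with h
      · subst h
        have : Nonempty (T 0) := ⟨⟨(fun _ => 0, fun _ => 0), by simp⟩⟩
        have : Nat.card {x : T 0 // 0 = 0} = 1 := by
          rw [Nat.card_eq_one_iff_unique]
          exact ⟨inferInstance, ⟨⟨Classical.arbitrary _, rfl⟩⟩⟩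
        exact_mod_cast this
      · have : IsEmpty {x : T 0 // 0 = k} := ⟨fun x => h x.2.symm⟩
        simp
  | succ a ih =>
    intro e hd
    obtain ⟨f0, g0⟩ := ih (e + 1) fun d h1 h2 => hd d h1 (by omega)
    have f1 := finite_step (w a (e + 1)) (e + 1) (by omega) f0
    have g1 := good_step ℓ _ (e + 1) (by omega) hℓ (hd _ (by omega) (by omega)) _ _
      (gf_step (w a (e + 1)) (e + 1) (by omega) f0) g0
    have f2 := finite_step _ (e + 2) (by omega) f1
    have g2 := good_step ℓ _ (e + 2) (by omega) hℓ (hd _ (by omega) (by omega)) _ _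
      (gf_step _ (e + 2) (by omega) f1) g1
    constructor
    · intro k
      have := f2 k
      exact Finite.of_equiv _ ((toggle a).subtypeEquiv (p := fun x => w (a + 1) e x = k)
        (q := fun x => w a (e + 1) x.1.1 + (e + 1) * x.1.2 + (e + 2) * x.2 = k)
        (fun x => by rw [w_toggle])).symm
    · have : gf (w (a + 1) e) = gf (fun x : (T a × ℕ) × ℕ =>
          (fun x : T a × ℕ => w a (e + 1) x.1 + (e + 1) * x.2) x.1 + (e + 2) * x.2) := by
        unfold gf
        congr 1
        funext k
        rw [cnt_congr (toggle a) (w (a + 1) e) (fun x : (T a × ℕ) × ℕ =>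
          (fun x : T a × ℕ => w a (e + 1) x.1 + (e + 1) * x.2) x.1 + (e + 2) * x.2) (w_toggle a e)]
      rw [this]
      exact g2

/-- Expansion of the inverse power. -/
noncomputable def Hs (ℓ D : ℕ) : PowerSeries ℚ :=
  PowerSeries.mk fun n => if ℓ ∣ n then ((n / ℓ + D).choose D : ℚ) else 0

lemma Hs_mul (ℓ : ℕ) (hℓ : 1 ≤ ℓ) (D : ℕ) : Hs ℓ D * (1 - PowerSeries.X ^ ℓ) ^ (D + 1) = 1 := by
  induction D with
  | zero =>
    ext k
    rw [zero_add, pow_one, mul_sub, mul_one, map_sub, PowerSeries.coeff_mul_X_pow']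
    simp only [Hs, PowerSeries.coeff_mk, PowerSeries.coeff_one]
    by_cases h0 : k = 0
    · subst h0; simp; omega
    · by_cases h : ℓ ≤ k
      · have hh : ℓ ∣ k - ℓ ↔ ℓ ∣ k := Nat.dvd_sub_iff_left h dvd_rfl
        simp [h, h0, hh]
      · have : ¬ ℓ ∣ k := fun hh => h (Nat.le_of_dvd (by omega) hh)
        simp [h, h0, this]
  | succ D ih =>
    suffices key : Hs ℓ (D + 1) * (1 - PowerSeries.X ^ ℓ) = Hs ℓ D by
      rw [pow_succ' _ (D + 1), ← mul_assoc, key, ih]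
    ext k
    rw [mul_sub, mul_one, map_sub, PowerSeries.coeff_mul_X_pow']
    simp only [Hs, PowerSeries.coeff_mk]
    by_cases hk : ℓ ∣ k
    · obtain ⟨q, rfl⟩ := hk
      rcases q with (_ | q)
      · have : ¬ ℓ ≤ 0 := by omega
        simp [this]
      · have h1 : ℓ ≤ ℓ * (q + 1) := Nat.le_mul_of_pos_right _ (by omega)
        have h2 : ℓ * (q + 1) - ℓ = ℓ * q := by rw [mul_add, mul_one, Nat.add_sub_cancel]
        rw [if_pos (dvd_mul_right _ _), if_pos h1, h2, if_pos (dvd_mul_right _ _),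
          if_pos (dvd_mul_right _ _), Nat.mul_div_cancel_left _ hℓ, Nat.mul_div_cancel_left _ hℓ]
        have : (q + 1 + (D + 1)).choose (D + 1) =
            (q + 1 + D).choose D + (q + (D + 1)).choose (D + 1) := by
          rw [show q + 1 + (D + 1) = (q + 1 + D) + 1 by ring, Nat.choose_succ_succ,
            show q + (D + 1) = q + 1 + D by ring]
        rw [this]; push_cast; ring
    · rw [if_neg hk, if_neg hk]
      split_ifs with h1 h2
      · exact absurd ((Nat.dvd_sub_iff_left h1 dvd_rfl).1 h2) hk
      · simp
      · simp

/-- One summand of the quasipolynomial. -/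
noncomputable def B (ℓ D s : ℕ) : ℚ[X] :=
  C ((D.factorial : ℚ)⁻¹) * (ascPochhammer ℚ D).comp (C ((ℓ : ℚ)⁻¹) * X + C (1 - s / ℓ : ℚ))

lemma B_natDegree (ℓ D s : ℕ) : (B ℓ D s).natDegree ≤ D := by
  unfold B
  refine (natDegree_C_mul_le _ _).trans (natDegree_comp_le.trans ?_)
  rw [ascPochhammer_natDegree]
  calc D * _ ≤ D * 1 := Nat.mul_le_mul_left _ natDegree_linear_le
    _ = D := mul_one _

lemma B_coeff (ℓ D s : ℕ) (hℓ : 1 ≤ ℓ) : 0 < (B ℓ D s).coeff D := by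
  have hl : (0 : ℚ) < (ℓ : ℚ)⁻¹ := by positivity
  have hlin : (C ((ℓ : ℚ)⁻¹) * X + C (1 - s / ℓ : ℚ)).natDegree = 1 := natDegree_linear hl.ne'
  unfold B
  rw [coeff_C_mul]
  have hdeg : ((ascPochhammer ℚ D).comp (C ((ℓ : ℚ)⁻¹) * X + C (1 - s / ℓ : ℚ))).natDegree = D := by
    rw [natDegree_comp, ascPochhammer_natDegree, hlin, mul_one]
  have h2 : ((ascPochhammer ℚ D).comp (C ((ℓ : ℚ)⁻¹) * X + C (1 - s / ℓ : ℚ))).leadingCoeff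
      = ((ℓ : ℚ)⁻¹) ^ D := by
    rw [leadingCoeff_comp (by rw [hlin]; norm_num), (monic_ascPochhammer ℚ D).leadingCoeff, one_mul,
      ascPochhammer_natDegree, leadingCoeff_linear hl.ne']
  rw [leadingCoeff, hdeg] at h2
  rw [h2]
  positivity

lemma B_eval_pos (ℓ D s q : ℕ) (hℓ : 1 ≤ ℓ) :
    (B ℓ D s).eval ((s + ℓ * q : ℕ) : ℚ) = ((q + D).choose D : ℚ) := by
  have hl : (ℓ : ℚ) ≠ 0 := by positivity
  have h : (ℓ : ℚ)⁻¹ * ((s + ℓ * q : ℕ) : ℚ) + (1 - s / ℓ) = ((q + 1 : ℕ) : ℚ) := by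
    push_cast; field_simp; ring
  simp only [B, eval_mul, eval_C, eval_comp, eval_add, eval_X]
  rw [h, ← ascPochhammer_eval_cast, ascPochhammer_nat_eq_ascFactorial,
    Nat.ascFactorial_eq_factorial_mul_choose]
  push_cast
  field_simp

lemma B_eval_neg (ℓ D s k q : ℕ) (hℓ : 1 ≤ ℓ) (hs : s = k + ℓ * (q + 1)) (hq : q < D) :
    (B ℓ D s).eval (k : ℚ) = 0 := by
  have hl : (ℓ : ℚ) ≠ 0 := by positivity
  have h : (ℓ : ℚ)⁻¹ * (k : ℚ) + (1 - s / ℓ) = -(q : ℚ) := by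
    rw [hs]; push_cast; field_simp; ring
  simp only [B, eval_mul, eval_C, eval_comp, eval_add, eval_X]
  rw [h, ascPochhammer_eval_neg_coe_nat_of_lt hq, mul_zero]

lemma quasi (ℓ D : ℕ) (hℓ : 1 ≤ ℓ) (G : PowerSeries ℚ) (hG : Good ℓ (D + 1) G) :
    ∃ f : ℕ → ℚ[X], (∀ i, i < ℓ → (f i).degree ≤ D) ∧ (∃ i, i < ℓ ∧ (f i).degree = D) ∧
      ∀ k : ℕ, PowerSeries.coeff k G = (f (k % ℓ)).eval (k : ℚ) := by
  obtain ⟨p, h1, h2, h3, h4⟩ := hG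
  have hGp : G = (p : PowerSeries ℚ) * Hs ℓ D := by
    rw [← h4, mul_assoc, mul_comm _ (Hs ℓ D), Hs_mul ℓ hℓ, mul_one]
  let N := (D + 1) * ℓ
  have hNpos : 0 < N := by positivity
  let f : ℕ → ℚ[X] := fun i => ∑ s ∈ Finset.range N, if s % ℓ = i then C (p.coeff s) * B ℓ D s else 0
  have hdeg : ∀ i, (f i).degree ≤ D := by
    intro i
    rw [← natDegree_le_iff_degree_le]
    apply natDegree_sum_le_of_forall_le
    intro s _
    split_ifs
    · exact (natDegree_C_mul_le _ _).trans (B_natDegree _ _ _)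
    · simp
  refine ⟨f, fun i _ => hdeg i, ⟨0, hℓ, ?_⟩, ?_⟩
  · refine le_antisymm (hdeg 0) (le_degree_of_ne_zero (ne_of_gt ?_))
    simp only [f, finsetSum_coeff]
    apply Finset.sum_pos'
    · intro s _
      split_ifs
      · rw [coeff_C_mul]; exact mul_nonneg (h2 _) (B_coeff _ _ _ hℓ).le
      · simp
    · refine ⟨0, Finset.mem_range.2 hNpos, ?_⟩
      rw [if_pos (Nat.zero_mod _), coeff_C_mul, h3, one_mul]
      exact B_coeff _ _ _ hℓ
  · intro k
    rw [hGp, PowerSeries.coeff_mul,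
      Finset.Nat.sum_antidiagonal_eq_sum_range_succ
        (fun i j => PowerSeries.coeff i (p : PowerSeries ℚ) * PowerSeries.coeff j (Hs ℓ D))]
    simp only [f, eval_finsetSum, Polynomial.coeff_coe, Hs, PowerSeries.coeff_mk]
    -- extend both sums to a common range
    let t : ℕ → ℚ := fun s => if s ≤ k ∧ s % ℓ = k % ℓ then
      p.coeff s * (((k - s) / ℓ + D).choose D : ℚ) else 0
    have hL : ∑ s ∈ Finset.range k.succ, p.coeff s *
        (if ℓ ∣ k - s then (((k - s) / ℓ + D).choose D : ℚ) else 0) =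
        ∑ s ∈ Finset.range (k + 1 + N), t s := by
      rw [← Finset.sum_subset (Finset.range_mono (show k.succ ≤ k + 1 + N by omega))]
      · apply Finset.sum_congr rfl
        intro s hs
        have hs' : s ≤ k := by rw [Finset.mem_range] at hs; omega
        have : ℓ ∣ k - s ↔ s % ℓ = k % ℓ := (Nat.modEq_iff_dvd' hs').symm
        simp only [t, hs', true_and, this]
        split_ifs <;> simp
      · intro s _ hs
        have : ¬ s ≤ k := by rw [Finset.mem_range] at hs; omega
        simp [t, this]
    have hR : ∑ s ∈ Finset.range N,
        eval (k : ℚ) (if s % ℓ = k % ℓ then C (p.coeff s) * B ℓ D s else 0) =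
        ∑ s ∈ Finset.range (k + 1 + N), t s := by
      rw [← Finset.sum_subset (Finset.range_mono (show N ≤ k + 1 + N by omega))]
      · apply Finset.sum_congr rfl
        intro s hs
        by_cases hm : s % ℓ = k % ℓ
        · simp only [t, hm, and_true, if_true, eval_mul, eval_C]
          by_cases hs' : s ≤ k
          · rw [if_pos hs']
            obtain ⟨q, hq⟩ := (Nat.modEq_iff_dvd' hs').1 hm
            have hk : k = s + ℓ * q := by omega
            rw [hq, Nat.mul_div_cancel_left _ hℓ, hk, B_eval_pos _ _ _ _ hℓ]
          · rw [if_neg hs']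
            by_cases hpd : s ≤ p.natDegree
            · obtain ⟨q, hq⟩ := (Nat.modEq_iff_dvd' (by omega : k ≤ s)).1 hm.symm
              rcases q with (_ | q)
              · omega
              · have hqD : q < D := by
                  by_contra hcon
                  have : ℓ * (D + 1) ≤ ℓ * (q + 1) := Nat.mul_le_mul_left _ (by omega)
                  rw [mul_comm (D + 1)] at h1
                  omega
                rw [B_eval_neg ℓ D s k q hℓ (by omega) hqD, mul_zero]
            · rw [coeff_eq_zero_of_natDegree_lt (by omega), zero_mul]
        · simp [t, hm]
      · intro s _ hs
        have : p.natDegree < s := by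
          rw [Finset.mem_range] at hs
          have : N ≤ s := by omega
          simp only [N] at this
          omega
        simp [t, coeff_eq_zero_of_natDegree_lt this]
    rw [hL, hR]

/-- Extension of a finite row by zero. -/
def ext0 {a : ℕ} (g : Fin a → ℕ) (j : ℕ) : ℕ := if h : j < a then g ⟨j, h⟩ else 0

lemma count_eq (a k : ℕ) : planePartitionCount a k = cnt (w a 0) k := by
  unfold planePartitionCount cnt
  symm
  apply Nat.card_congr
  have anti : ∀ x : ℕ → ℕ, (∀ j, x (j + 1) ≤ x j) → Antitone x := fun x h => antitone_nat_of_succ_le h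
  refine Equiv.ofBijective (fun p => ⟨fun i j => if i = 0 then p.1.1.1 j else p.1.1.2 j, ?_, ?_, ?_⟩)
    ⟨?_, ?_⟩
  · intro i j j' hj
    obtain ⟨⟨⟨x, y⟩, h1, h2, h3, h4⟩, hk⟩ := p
    simp only
    split_ifs
    · exact anti _ h1 hj
    · exact anti _ h2 hj
  · intro j
    simpa using p.1.2.2.2.1 j
  · obtain ⟨⟨⟨x, y⟩, h1, h2, h3, h4⟩, hk⟩ := p
    simp only [w, zero_mul, add_zero] at hk
    rw [Finset.sum_add_distrib, Finset.sum_range, Finset.sum_range] at hk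
    rw [Fin.sum_univ_two]
    refine Eq.trans ?_ hk
    simp
  · rintro ⟨⟨⟨x, y⟩, h1, h2, h3, h4⟩, hk⟩ ⟨⟨⟨x', y'⟩, h1', h2', h3', h4'⟩, hk'⟩ h
    simp only [Subtype.mk.injEq] at h
    simp only at h1 h2 h3 h4 h1' h2' h3' h4'
    have hx : x = x' := by
      funext j
      by_cases hj : j < a
      · simpa using congrFun (congrFun h 0) ⟨j, hj⟩
      · rw [h4 j (by omega), h4' j (by omega)]
    have hy : y = y' := by
      funext j
      by_cases hj : j < a
      · simpa using congrFun (congrFun h 1) ⟨j, hj⟩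
      · have := h3 j; have := h3' j; have := h4 j (by omega); have := h4' j (by omega)
        omega
    subst hx hy
    rfl
  · rintro ⟨f, h1, h2, h3⟩
    have hdec : ∀ i j, ext0 (f i) (j + 1) ≤ ext0 (f i) j := by
      intro i j
      unfold ext0
      split_ifs
      · exact h1 _ _ _ (by simp [Fin.le_def])
      · omega
      · omega
      · omega
    refine ⟨⟨⟨(ext0 (f 0), ext0 (f 1)), hdec 0, hdec 1, ?_, ?_⟩, ?_⟩, ?_⟩
    · intro j
      simp only [ext0]
      split_ifs
      · exact h2 _
      · omega
    · intro j hj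
      simp [ext0, Nat.not_lt.2 hj]
    · rw [← h3, Fin.sum_univ_two]
      simp only [w, zero_mul, add_zero, Finset.sum_add_distrib, Finset.sum_range]
      simp [ext0]
    · apply Subtype.ext
      funext i j
      fin_cases i <;> simp [ext0]

end PPQ

theorem planePartitionCount_quasipolynomial (a : ℕ) (ha : 1 ≤ a)
    (ℓ : ℕ) (hℓ : ℓ = Finset.lcm (Finset.Icc 1 (a + 1)) id) :
    ∃ f : ℕ → Polynomial ℚ,
      (∀ i, i < ℓ → (f i).degree ≤ (2 * a - 1 : ℕ)) ∧
      (∃ i, i < ℓ ∧ (f i).degree = (2 * a - 1 : ℕ)) ∧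
      ∀ k : ℕ, (planePartitionCount a k : ℚ) = (f (k % ℓ)).eval (k : ℚ) := by
  have hpos : 1 ≤ ℓ := by
    rw [hℓ, Nat.one_le_iff_ne_zero, Ne, Finset.lcm_eq_zero_iff]
    simp
  have hdvd : ∀ d, 1 ≤ d → d ≤ 0 + a + 1 → d ∣ ℓ := by
    intro d h1 h2
    rw [hℓ]
    exact Finset.dvd_lcm (f := id) (Finset.mem_Icc.2 ⟨h1, by omega⟩)
  have hg := (PPQ.main_gf ℓ hpos a 0 hdvd).2
  rw [show 2 * a = (2 * a - 1) + 1 by omega] at hg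
  obtain ⟨f, hf1, hf2, hf3⟩ := PPQ.quasi ℓ (2 * a - 1) hpos _ hg
  refine ⟨f, hf1, hf2, fun k => ?_⟩
  rw [← hf3 k, PPQ.count_eq, PPQ.gf, PowerSeries.coeff_mk]
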